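/- Let κ : ℝ → ℂ be an even Schwartz function vanishing on (−δ, δ) for some δ > 0. Then the function 𝔪κ defined by 𝔪κ(λ) = |c(λ)|^{−2} |λ|^{−(n−1)} κ(λ) for |λ| ≥ δ and 𝔪κ(λ) = 0 for |λ| < δ is again an even Schwartz function vanishing on (−δ, δ); likewise the function λ ↦ |c(λ)|² |λ|^{n−1} κ(λ) (extended by 0 on (−δ, δ)) is an even Schwartz function vanishing on (−δ, δ). Consequently, κ ↦ 𝔪κ is a bijection of the space of even Schwartz functions on ℝ whose support avoids a neighbourhood of 0. -/

import Mathlib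

open MeasureTheory Filter Set

noncomputable section

/-- The half-sum of roots `ρ = Q/2 = (m_v/2 + m_z)/2`. -/
def rhoDR (mv mz : ℕ) : ℝ := ((mv : ℝ) / 2 + mz) / 2

/-- The Harish-Chandra `c`-function of the Damek–Ricci space:
`c(λ) = 4^{ρ-iλ} (Γ(2iλ)/Γ(ρ+iλ)) (Γ(n/2)/Γ((m_v+4iλ+2)/4))`. -/
def cHC (mv mz : ℕ) (l : ℝ) : ℂ :=
  (4 : ℂ) ^ ((rhoDR mv mz : ℂ) - Complex.I * l)
    * (Complex.Gamma (2 * Complex.I * l)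
        / Complex.Gamma ((rhoDR mv mz : ℂ) + Complex.I * l))
    * (Complex.Gamma (((mv : ℂ) + mz + 1) / 2)
        / Complex.Gamma (((mv : ℂ) + 4 * Complex.I * l + 2) / 4))

/-- The multiplier `|c(λ)|⁻² |λ|^{-(n-1)}` (here `n - 1 = m_v + m_z`). -/
def multDR (mv mz : ℕ) (l : ℝ) : ℝ :=
  (‖cHC mv mz l‖ ^ 2)⁻¹ * (|l| ^ (mv + mz))⁻¹

/-- Even Schwartz functions whose support avoids a neighbourhood of `0`. -/
def EvenAwayZero (κ : SchwartzMap ℝ ℂ) : Prop :=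
  (∀ x, κ (-x) = κ x) ∧ ∃ δ : ℝ, 0 < δ ∧ ∀ x : ℝ, |x| < δ → κ x = 0

end

lemma iter_real_aux (f : ℂ → ℂ) (S : Set ℂ) (hS : IsOpen S) (hf : DifferentiableOn ℂ f S) (k : ℕ) :
    ∀ x : ℝ, (x : ℂ) ∈ S → iteratedDeriv k (fun t : ℝ => f t) x = iteratedDeriv k f x := by
  induction k with
  | zero => intro x hx; simp
  | succ k ih =>
    intro x hx
    rw [iteratedDeriv_succ, iteratedDeriv_succ]
    have hev : (iteratedDeriv k (fun t : ℝ => f t)) =ᶠ[nhds x]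
        (fun t : ℝ => iteratedDeriv k f t) := by
      have : ∀ᶠ t : ℝ in nhds x, (t : ℂ) ∈ S :=
        Complex.continuous_ofReal.continuousAt.eventually (hS.mem_nhds hx)
      filter_upwards [this] with t ht using ih t ht
    rw [hev.deriv_eq]
    have hd : DifferentiableAt ℂ (iteratedDeriv k f) x := by
      rw [iteratedDeriv_eq_iterate]
      exact (((hf.analyticOnNhd hS).iterated_deriv k) x hx).differentiableAt
    exact hd.hasDerivAt.comp_ofReal.deriv

lemma schwartz_mul_aux (g : ℝ → ℂ) (δ r C : ℝ) (N : ℕ) (hδ : 0 < δ) (hr : 0 < r)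
    (H : ∀ x : ℝ, δ / 2 < |x| → ∃ f : ℂ → ℂ, DifferentiableOn ℂ f (Metric.ball (x : ℂ) r) ∧
      (∀ w ∈ Metric.ball (x : ℂ) r, ‖f w‖ ≤ C * (1 + |x|) ^ N) ∧
      ∀ t : ℝ, (t : ℂ) ∈ Metric.ball (x : ℂ) r → g t = f t)
    (κ : SchwartzMap ℝ ℂ) (hκ : ∀ x : ℝ, |x| < δ → κ x = 0) :
    ∃ σ : SchwartzMap ℝ ℂ, ∀ x, σ x = g x * κ x := by
  have hgev : ∀ x : ℝ, ∀ f : ℂ → ℂ,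
      (∀ t : ℝ, (t : ℂ) ∈ Metric.ball (x : ℂ) r → g t = f t) →
      g =ᶠ[nhds x] (fun t : ℝ => f t) := by
    intro x f h3
    have : ∀ᶠ t : ℝ in nhds x, (t : ℂ) ∈ Metric.ball (x : ℂ) r :=
      Complex.continuous_ofReal.continuousAt.eventually (Metric.ball_mem_nhds _ hr)
    filter_upwards [this] with t ht using h3 t ht
  have hgs : ∀ x : ℝ, δ / 2 < |x| → ContDiffAt ℝ (⊤ : ℕ∞) g x := by
    intro x hx
    obtain ⟨f, h1, h2, h3⟩ := H x hx
    refine ContDiffAt.congr_of_eventuallyEq ?_ (hgev x f h3)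
    have ha : AnalyticAt ℂ f x :=
      (h1.analyticOnNhd Metric.isOpen_ball) x (Metric.mem_ball_self hr)
    have hc : ContDiffAt ℝ (⊤ : ℕ∞) f (x : ℂ) := (ha.contDiffAt (n := (⊤ : ℕ∞))).restrict_scalars ℝ
    exact hc.comp x (Complex.ofRealCLM.contDiff.contDiffAt)
  have hgb : ∀ (k : ℕ) (x : ℝ), δ / 2 < |x| →
      ‖iteratedFDeriv ℝ k g x‖ ≤ (k.factorial * C / (r / 2) ^ k) * (1 + |x|) ^ N := by
    intro k x hx
    obtain ⟨f, h1, h2, h3⟩ := H x hx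
    rw [norm_iteratedFDeriv_eq_norm_iteratedDeriv, (hgev x f h3).iteratedDeriv_eq k,
      iter_real_aux f _ Metric.isOpen_ball h1 k x (Metric.mem_ball_self hr)]
    have hsub : Metric.closedBall (x : ℂ) (r / 2) ⊆ Metric.ball (x : ℂ) r :=
      Metric.closedBall_subset_ball (by linarith)
    have := Complex.norm_iteratedDeriv_le_of_forall_mem_sphere_norm_le k (half_pos hr)
      (h1.diffContOnCl_ball hsub)
      (fun z hz => h2 z (hsub (Metric.sphere_subset_closedBall hz)))
    refine this.trans (le_of_eq ?_)
    ring
  have hzero : ∀ x : ℝ, |x| < δ → (fun t => g t * κ t) =ᶠ[nhds x] (fun _ => 0) := by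
    intro x hx
    have : ∀ᶠ t : ℝ in nhds x, |t| < δ :=
      continuous_abs.continuousAt.eventually (gt_mem_nhds hx)
    filter_upwards [this] with t ht
    simp [hκ t ht]
  have hsm : ContDiff ℝ (⊤ : ℕ∞) (fun t => g t * κ t) := by
    rw [contDiff_iff_contDiffAt]
    intro x
    by_cases hx : |x| < δ
    · exact contDiffAt_const.congr_of_eventuallyEq (hzero x hx)
    · exact (hgs x (by linarith)).mul (κ.smooth _).contDiffAt
  have hU : IsOpen {x : ℝ | δ / 2 < |x|} := isOpen_lt continuous_const continuous_abs
  refine ⟨⟨fun t => g t * κ t, hsm, ?_⟩, fun x => rfl⟩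
  intro k n
  have hC : 0 ≤ C := by
    obtain ⟨f, h1, h2, h3⟩ := H δ (by rw [abs_of_pos hδ]; linarith)
    have h := (norm_nonneg _).trans (h2 _ (Metric.mem_ball_self hr))
    exact nonneg_of_mul_nonneg_left h (by positivity)
  set B : ℕ → ℝ := fun i => 2 ^ (k + N) *
    (Finset.Iic (k + N, i)).sup (fun m => SchwartzMap.seminorm ℝ (E := ℝ) (F := ℂ) m.1 m.2) κ with hB
  have hBn : ∀ i, 0 ≤ B i := fun i => by positivity
  refine ⟨∑ i ∈ Finset.range (n + 1), (n.choose i : ℝ) * (i.factorial * C / (r / 2) ^ i) * B (n - i), ?_⟩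
  intro x
  by_cases hx : |x| < δ
  · have : iteratedFDeriv ℝ n (fun t => g t * κ t) x = 0 := by
      rw [((hzero x hx).iteratedFDeriv (𝕜 := ℝ) n).eq_of_nhds]
      simp
    rw [this, norm_zero, mul_zero]
    exact Finset.sum_nonneg fun i _ => by have := hBn (n - i); positivity
  · have hx' : δ / 2 < |x| := by linarith
    have hm := norm_iteratedFDerivWithin_mul_le (𝕜 := ℝ) (N := (⊤ : ℕ∞)) (f := g) (g := κ)
      (s := {x : ℝ | δ / 2 < |x|}) (fun y hy => (hgs y hy).contDiffWithinAt)
      (κ.smooth _).contDiffOn hU.uniqueDiffOn (x := x) hx' (n := n) (by exact_mod_cast le_top)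
    simp only [iteratedFDerivWithin_of_isOpen _ hU hx'] at hm
    refine (mul_le_mul_of_nonneg_left hm (by positivity)).trans ?_
    rw [Finset.mul_sum]
    refine Finset.sum_le_sum fun i _ => ?_
    have h1 := hgb i x hx'
    have h2 := SchwartzMap.one_add_le_sup_seminorm_apply (𝕜 := ℝ) (m := (k + N, n - i))
      le_rfl le_rfl κ x
    rw [Real.norm_eq_abs] at *
    have h3 : |x| ^ k ≤ (1 + |x|) ^ k := by gcongr; linarith
    calc |x| ^ k * ((n.choose i : ℝ) * ‖iteratedFDeriv ℝ i g x‖ * ‖iteratedFDeriv ℝ (n - i) κ x‖)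
        ≤ (1 + |x|) ^ k * ((n.choose i : ℝ) * ((i.factorial * C / (r / 2) ^ i) * (1 + |x|) ^ N)
          * ‖iteratedFDeriv ℝ (n - i) κ x‖) := by gcongr
      _ = (n.choose i : ℝ) * (i.factorial * C / (r / 2) ^ i) *
          ((1 + |x|) ^ (k + N) * ‖iteratedFDeriv ℝ (n - i) κ x‖) := by ring
      _ ≤ _ := by gcongr

lemma gamma_mono_aux (s t x : ℝ) (hs : 0 < s) (hst : s ≤ t) :
    ‖Complex.Gamma (s + x * Complex.I)‖ * Real.Gamma t ≤
      ‖Complex.Gamma (t + x * Complex.I)‖ * Real.Gamma s := by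
  have key : ∀ u : ℝ, ∀ n : ℕ, 0 < n → ‖Complex.GammaSeq (u + x * Complex.I) n‖ =
      (n : ℝ) ^ u * n.factorial / ∏ j ∈ Finset.range (n + 1), ‖(u : ℂ) + x * Complex.I + j‖ := by
    intro u n hn
    rw [Complex.GammaSeq, norm_div, norm_mul, norm_prod, Complex.norm_natCast_cpow_of_pos hn]
    simp
  refine le_of_tendsto_of_tendsto
    ((Complex.GammaSeq_tendsto_Gamma _).norm.mul (Real.GammaSeq_tendsto_Gamma t))
    ((Complex.GammaSeq_tendsto_Gamma _).norm.mul (Real.GammaSeq_tendsto_Gamma s)) ?_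
  filter_upwards [eventually_gt_atTop 0] with n hn
  rw [key s n hn, key t n hn, Real.GammaSeq, Real.GammaSeq, div_mul_div_comm, div_mul_div_comm,
    ← Finset.prod_mul_distrib, ← Finset.prod_mul_distrib]
  have ht : 0 < t := hs.trans_le hst
  have hpos : ∀ u : ℝ, 0 < u → ∀ j : ℕ, 0 < ‖(u : ℂ) + x * Complex.I + j‖ := by
    intro u hu j
    rw [norm_pos_iff]
    intro h
    have := congrArg Complex.re h
    simp at this
    have : (0 : ℝ) ≤ j := by positivity
    linarith
  have hsq : ∀ u : ℝ, ∀ j : ℕ, ‖(u : ℂ) + x * Complex.I + j‖ ^ 2 = (u + j) ^ 2 + x ^ 2 := by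
    intro u j
    rw [← Complex.normSq_eq_norm_sq, Complex.normSq_apply]
    simp
    ring
  have hle : ∏ j ∈ Finset.range (n + 1), ‖(t : ℂ) + x * Complex.I + j‖ * (s + j) ≤
      ∏ j ∈ Finset.range (n + 1), ‖(s : ℂ) + x * Complex.I + j‖ * (t + j) := by
    refine Finset.prod_le_prod (fun j _ => by positivity) fun j _ => ?_
    refine le_of_sq_le_sq ?_ (by positivity)
    rw [mul_pow, mul_pow, hsq, hsq]
    have : (s + j) ^ 2 ≤ (t + j) ^ 2 := by gcongr
    nlinarith [mul_le_mul_of_nonneg_left this (sq_nonneg x)]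
  have hp : 0 < ∏ j ∈ Finset.range (n + 1), ‖(t : ℂ) + x * Complex.I + j‖ * (s + j) :=
    Finset.prod_pos fun j _ => mul_pos (hpos t ht j) (by positivity)
  calc _ ≤ (n : ℝ) ^ s * n.factorial * ((n : ℝ) ^ t * n.factorial) /
        ∏ j ∈ Finset.range (n + 1), ‖(t : ℂ) + x * Complex.I + j‖ * (s + j) := by gcongr
    _ = _ := by ring

lemma gamma_half_aux (x : ℝ) :
    ‖Complex.Gamma (1 / 2 + x * Complex.I)‖ ^ 2 = Real.pi / Real.cosh (Real.pi * x) := by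
  have h := Complex.Gamma_mul_Gamma_one_sub (1 / 2 + x * Complex.I)
  have h1 : (1 : ℂ) - (1 / 2 + x * Complex.I) = (starRingEnd ℂ) (1 / 2 + x * Complex.I) := by
    apply Complex.ext <;> simp
    norm_num
  have h2 : Complex.sin (Real.pi * (1 / 2 + x * Complex.I)) = Real.cosh (Real.pi * x) := by
    rw [show (Real.pi : ℂ) * (1 / 2 + x * Complex.I) =
      (Real.pi * x : ℂ) * Complex.I + Real.pi / 2 by ring, Complex.sin_add_pi_div_two,
      Complex.cos_mul_I]
    push_cast
    rfl
  rw [h1, Complex.Gamma_conj, h2, Complex.mul_conj, Complex.normSq_eq_norm_sq] at h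
  exact_mod_cast h

lemma cosh_le_aux (x : ℝ) : Real.cosh x ≤ Real.exp |x| := by
  rw [← Real.cosh_abs, Real.cosh_eq]
  have : Real.exp (-|x|) ≤ Real.exp |x| := Real.exp_le_exp.2 (by linarith [abs_nonneg x])
  linarith

lemma le_cosh_aux (x : ℝ) : Real.exp |x| ≤ 2 * Real.cosh x := by
  rw [← Real.cosh_abs, Real.cosh_eq]
  have := Real.exp_pos (-|x|)
  linarith

lemma gamma_half_lower (x : ℝ) :
    Real.exp (-(Real.pi / 2 * |x|)) ≤ ‖Complex.Gamma (1 / 2 + x * Complex.I)‖ := by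
  refine le_of_sq_le_sq ?_ (norm_nonneg _)
  rw [gamma_half_aux, ← Real.exp_nat_mul, le_div_iff₀ (Real.cosh_pos _)]
  have h := cosh_le_aux (Real.pi * x)
  rw [abs_mul, abs_of_pos Real.pi_pos] at h
  calc _ ≤ Real.exp ((2 : ℕ) * -(Real.pi / 2 * |x|)) * Real.exp (Real.pi * |x|) := by gcongr
    _ = 1 := by rw [← Real.exp_add, Real.exp_eq_one_iff]; push_cast; ring
    _ ≤ _ := by linarith [Real.pi_gt_three]

lemma gamma_half_upper (x : ℝ) :
    ‖Complex.Gamma (1 / 2 + x * Complex.I)‖ ≤ 3 * Real.exp (-(Real.pi / 2 * |x|)) := by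
  refine le_of_sq_le_sq ?_ (by positivity)
  rw [gamma_half_aux, mul_pow, ← Real.exp_nat_mul, div_le_iff₀ (Real.cosh_pos _)]
  have h := le_cosh_aux (Real.pi * x)
  rw [abs_mul, abs_of_pos Real.pi_pos] at h
  have h1 : Real.exp ((2 : ℕ) * -(Real.pi / 2 * |x|)) * Real.exp (Real.pi * |x|) = 1 := by
    rw [← Real.exp_add, Real.exp_eq_one_iff]; push_cast; ring
  have h2 := mul_le_mul_of_nonneg_left h (Real.exp_pos ((2 : ℕ) * -(Real.pi / 2 * |x|))).le
  nlinarith [Real.pi_le_four]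

lemma gamma_half_nat_upper (N : ℕ) : ∃ C : ℝ, 0 < C ∧ ∀ x : ℝ,
    ‖Complex.Gamma (((N : ℝ) + 1 / 2 : ℝ) + x * Complex.I)‖ ≤
      C * (1 + |x|) ^ N * Real.exp (-(Real.pi / 2 * |x|)) := by
  induction N with
  | zero =>
    refine ⟨3, by norm_num, fun x => ?_⟩
    simpa using gamma_half_upper x
  | succ N ih =>
    obtain ⟨C, hC, h⟩ := ih
    refine ⟨(N + 1) * C, by positivity, fun x => ?_⟩
    have hne : (((N : ℝ) + 1 / 2 : ℝ) + x * Complex.I : ℂ) ≠ 0 := by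
      intro h0
      have := congrArg Complex.re h0
      simp at this
      have : (0 : ℝ) ≤ N := by positivity
      linarith
    have hn : ‖(((N : ℝ) + 1 / 2 : ℝ) + x * Complex.I : ℂ)‖ ≤ (N + 1) * (1 + |x|) := by
      refine (norm_add_le _ _).trans ?_
      rw [Complex.norm_real, norm_mul, Complex.norm_real, Complex.norm_I, Real.norm_eq_abs,
        Real.norm_eq_abs, abs_of_nonneg (by positivity)]
      have : 0 ≤ (N : ℝ) * |x| := by positivity
      nlinarith
    rw [show ((((N + 1 : ℕ) : ℝ) + 1 / 2 : ℝ) + x * Complex.I : ℂ) =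
      (((N : ℝ) + 1 / 2 : ℝ) + x * Complex.I : ℂ) + 1 by push_cast; ring,
      Complex.Gamma_add_one _ hne, norm_mul]
    calc _ ≤ ((N + 1) * (1 + |x|)) * (C * (1 + |x|) ^ N * Real.exp (-(Real.pi / 2 * |x|))) := by
          gcongr
          exact h x
      _ = _ := by ring

lemma gamma_bounds_aux (N : ℕ) : ∃ C c : ℝ, 0 < C ∧ 0 < c ∧ ∀ w : ℂ,
    1 / 2 ≤ w.re → w.re ≤ N + 1 / 2 →
      ‖Complex.Gamma w‖ ≤ C * (1 + |w.im|) ^ N * Real.exp (-(Real.pi / 2 * |w.im|)) ∧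
      c * Real.exp (-(Real.pi / 2 * |w.im|)) ≤ ‖Complex.Gamma w‖ := by
  obtain ⟨C, hC, h⟩ := gamma_half_nat_upper N
  have hcont : ContinuousOn Real.Gamma (Icc (1 / 2) (N + 1 / 2)) :=
    Real.differentiableOn_Gamma_Ioi.continuousOn.mono
      (fun y hy => lt_of_lt_of_le (by norm_num) hy.1)
  have hne : (Icc (1 / 2 : ℝ) (N + 1 / 2)).Nonempty := ⟨1 / 2, by simp⟩
  obtain ⟨u, hu, hu'⟩ := isCompact_Icc.exists_isMaxOn hne hcont
  obtain ⟨v, hv, hv'⟩ := isCompact_Icc.exists_isMinOn hne hcont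
  have hup : 0 < Real.Gamma u := Real.Gamma_pos_of_pos (lt_of_lt_of_le (by norm_num) hu.1)
  have hvp : 0 < Real.Gamma v := Real.Gamma_pos_of_pos (lt_of_lt_of_le (by norm_num) hv.1)
  have hNp : 0 < Real.Gamma (N + 1 / 2) := Real.Gamma_pos_of_pos (by positivity)
  have hhp : 0 < Real.Gamma (1 / 2) := Real.Gamma_pos_of_pos (by norm_num)
  refine ⟨C * Real.Gamma u / Real.Gamma (N + 1 / 2), Real.Gamma v / Real.Gamma (1 / 2),
    by positivity, by positivity, fun w h1 h2 => ?_⟩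
  have hw : w = (w.re : ℂ) + w.im * Complex.I := (Complex.re_add_im w).symm
  have hum : Real.Gamma w.re ≤ Real.Gamma u := hu' ⟨h1, h2⟩
  have hvm : Real.Gamma v ≤ Real.Gamma w.re := hv' ⟨h1, h2⟩
  have m1 := gamma_mono_aux w.re (N + 1 / 2) w.im (by linarith) h2
  have m2 := gamma_mono_aux (1 / 2) w.re w.im (by norm_num) h1
  rw [← hw] at m1 m2
  constructor
  · have : ‖Complex.Gamma w‖ * Real.Gamma (N + 1 / 2) ≤
      (C * (1 + |w.im|) ^ N * Real.exp (-(Real.pi / 2 * |w.im|))) * Real.Gamma u := by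
      refine m1.trans ?_
      gcongr
      exact h w.im
    rw [← le_div_iff₀ hNp] at this
    refine this.trans (le_of_eq ?_)
    ring
  · have hl := gamma_half_lower w.im
    have e : ((1 / 2 : ℝ) : ℂ) = 1 / 2 := by push_cast; rfl
    rw [e] at m2
    have : Real.exp (-(Real.pi / 2 * |w.im|)) * Real.Gamma v ≤
        ‖Complex.Gamma w‖ * Real.Gamma (1 / 2) := by
      refine le_trans ?_ m2
      gcongr
    rw [← div_le_iff₀ hhp] at this
    refine le_trans (le_of_eq ?_) this
    ring

noncomputable def gDR (a b : ℝ) (z : ℂ) : ℂ :=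
  z * Complex.sinh (2 * Real.pi * z) *
    (Complex.Gamma (a + Complex.I * z) * Complex.Gamma (a - Complex.I * z)) *
    (Complex.Gamma (b + Complex.I * z) * Complex.Gamma (b - Complex.I * z))

lemma gDR_neg (a b : ℝ) (z : ℂ) : gDR a b (-z) = gDR a b z := by
  simp only [gDR, mul_neg, Complex.sinh_neg, sub_neg_eq_add, ← sub_eq_add_neg]
  ring

lemma gDR_diff (a b : ℝ) (ha : 3 / 4 ≤ a) (hb : 3 / 4 ≤ b) (z : ℂ) (hz : |z.im| ≤ 1 / 4) :
    DifferentiableAt ℂ (gDR a b) z := by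
  have hz' := abs_le.1 hz
  have hG : ∀ w : ℂ, 0 < w.re → DifferentiableAt ℂ Complex.Gamma w := by
    intro w hw
    refine Complex.differentiableAt_Gamma w fun m hm => ?_
    rw [hm] at hw
    simp at hw
    have : (0 : ℝ) ≤ m := by positivity
    linarith
  have h1 : ∀ u : ℝ, 3 / 4 ≤ u →
      DifferentiableAt ℂ (fun z : ℂ => Complex.Gamma (u + Complex.I * z)) z := by
    intro u hu
    exact (hG _ (by simp; linarith)).comp z (by fun_prop)
  have h2 : ∀ u : ℝ, 3 / 4 ≤ u →
      DifferentiableAt ℂ (fun z : ℂ => Complex.Gamma (u - Complex.I * z)) z := by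
    intro u hu
    exact (hG _ (by simp; linarith)).comp z (by fun_prop)
  have h3 : DifferentiableAt ℂ (fun z : ℂ => z * Complex.sinh (2 * Real.pi * z)) z := by
    fun_prop
  exact (h3.mul ((h1 a ha).mul (h2 a ha))).mul ((h1 b hb).mul (h2 b hb))

lemma sinh_upper_aux (w : ℂ) : ‖Complex.sinh w‖ ≤ Real.exp |w.re| := by
  rw [Complex.sinh, norm_div, Complex.norm_ofNat]
  have h := norm_sub_le (Complex.exp w) (Complex.exp (-w))
  rw [Complex.norm_exp, Complex.norm_exp, Complex.neg_re] at h
  have h1 : Real.exp w.re ≤ Real.exp |w.re| := Real.exp_le_exp.2 (le_abs_self _)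
  have h2 : Real.exp (-w.re) ≤ Real.exp |w.re| := Real.exp_le_exp.2 (neg_le_abs _)
  linarith

lemma sinh_lower_aux (w : ℂ) (t : ℝ) (ht : t ≤ |w.re|) :
    (1 - Real.exp (-(2 * t))) / 2 * Real.exp |w.re| ≤ ‖Complex.sinh w‖ := by
  have key : (Real.exp |w.re| - Real.exp (-|w.re|)) / 2 ≤ ‖Complex.sinh w‖ := by
    rw [Complex.sinh, norm_div, Complex.norm_ofNat]
    have h := norm_sub_norm_le (Complex.exp w) (Complex.exp (-w))
    have h' := norm_sub_norm_le (Complex.exp (-w)) (Complex.exp w)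
    rw [norm_sub_rev (Complex.exp (-w))] at h'
    rw [Complex.norm_exp, Complex.norm_exp, Complex.neg_re] at h h'
    rcases abs_cases w.re with ⟨e, _⟩ | ⟨e, _⟩
    · rw [e]; linarith
    · rw [e, neg_neg]; linarith
  refine le_trans ?_ key
  have : Real.exp (-|w.re|) ≤ Real.exp (-(2 * t)) * Real.exp |w.re| := by
    rw [← Real.exp_add]
    exact Real.exp_le_exp.2 (by linarith)
  linarith

lemma gDR_bounds (a b d : ℝ) (ha : 3 / 4 ≤ a) (hb : 3 / 4 ≤ b) (hd : 0 < d) :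
    ∃ (C c : ℝ) (N : ℕ), 0 < C ∧ 0 < c ∧ ∀ z : ℂ, |z.im| ≤ 1 / 4 → d ≤ |z.re| →
      ‖gDR a b z‖ ≤ C * (1 + |z.re|) ^ N ∧ c ≤ ‖gDR a b z‖ := by
  obtain ⟨N, hN⟩ := exists_nat_ge (a + b)
  obtain ⟨C, c, hC, hc, h⟩ := gamma_bounds_aux N
  have he : 0 < 1 - Real.exp (-(2 * (2 * Real.pi * d))) := by
    rw [sub_pos, Real.exp_lt_one_iff]
    have := Real.pi_pos
    rw [neg_lt_zero]
    positivity
  refine ⟨C ^ 4, d * ((1 - Real.exp (-(2 * (2 * Real.pi * d)))) / 2) * c ^ 4, 1 + 4 * N,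
    by positivity, by positivity, fun z hz hz2 => ?_⟩
  have hz' := abs_le.1 hz
  set x := z.re with hx
  have h1 : ∀ u : ℝ, 3 / 4 ≤ u → u + 1 / 4 ≤ N + 1 / 2 →
      (‖Complex.Gamma (u + Complex.I * z)‖ ≤ C * (1 + |x|) ^ N * Real.exp (-(Real.pi / 2 * |x|)) ∧
      c * Real.exp (-(Real.pi / 2 * |x|)) ≤ ‖Complex.Gamma (u + Complex.I * z)‖) ∧
      (‖Complex.Gamma (u - Complex.I * z)‖ ≤ C * (1 + |x|) ^ N * Real.exp (-(Real.pi / 2 * |x|)) ∧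
      c * Real.exp (-(Real.pi / 2 * |x|)) ≤ ‖Complex.Gamma (u - Complex.I * z)‖) := by
    intro u hu hu2
    constructor
    · have := h (u + Complex.I * z) (by simp; linarith) (by simp; linarith)
      simpa using this
    · have := h (u - Complex.I * z) (by simp; linarith) (by simp; linarith)
      simpa using this
  obtain ⟨⟨a1, a2⟩, ⟨a3, a4⟩⟩ := h1 a ha (by linarith)
  obtain ⟨⟨b1, b2⟩, ⟨b3, b4⟩⟩ := h1 b hb (by linarith)
  have hre : (2 * Real.pi * z : ℂ).re = 2 * Real.pi * x := by
    rw [show (2 * Real.pi * z : ℂ) = ((2 * Real.pi : ℝ) : ℂ) * z by push_cast; ring,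
      Complex.re_ofReal_mul]
  have habs : |2 * Real.pi * x| = 2 * Real.pi * |x| := by
    rw [abs_mul, abs_of_pos (by have := Real.pi_pos; positivity)]
  have s1 := sinh_upper_aux (2 * Real.pi * z)
  have s2 := sinh_lower_aux (2 * Real.pi * z) (2 * Real.pi * d) (by
    rw [hre, habs]; have := Real.pi_pos; gcongr)
  rw [hre, habs] at s1 s2
  have z1 : ‖z‖ ≤ 1 + |x| := (Complex.norm_le_abs_re_add_abs_im z).trans (by linarith)
  have z2 : d ≤ ‖z‖ := hz2.trans (Complex.abs_re_le_norm z)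
  have hexp : Real.exp (2 * Real.pi * |x|) * Real.exp (-(Real.pi / 2 * |x|)) ^ 4 = 1 := by
    rw [← Real.exp_nat_mul, ← Real.exp_add, Real.exp_eq_one_iff]; push_cast; ring
  set E := Real.exp (-(Real.pi / 2 * |x|)) with hE
  have hEp : 0 < E := Real.exp_pos _
  set P := Real.exp (2 * Real.pi * |x|) with hP
  have hPp : 0 < P := Real.exp_pos _
  simp only [gDR, norm_mul]
  constructor
  · calc _ ≤ (1 + |x|) * P * ((C * (1 + |x|) ^ N * E) * (C * (1 + |x|) ^ N * E)) *
          ((C * (1 + |x|) ^ N * E) * (C * (1 + |x|) ^ N * E)) := by gcongr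
      _ = C ^ 4 * (1 + |x|) ^ (1 + 4 * N) * (P * E ^ 4) := by ring
      _ = _ := by rw [hexp, mul_one]
  · calc _ = d * ((1 - Real.exp (-(2 * (2 * Real.pi * d)))) / 2) * c ^ 4 * (P * E ^ 4) := by
          rw [hexp, mul_one]
      _ = d * ((1 - Real.exp (-(2 * (2 * Real.pi * d)))) / 2 * P) * ((c * E) * (c * E)) *
          ((c * E) * (c * E)) := by ring
      _ ≤ _ := by gcongr

lemma gamma_normsq_aux (u l : ℝ) :
    ((‖Complex.Gamma (u + Complex.I * l)‖ ^ 2 : ℝ) : ℂ) =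
      Complex.Gamma (u + Complex.I * l) * Complex.Gamma (u - Complex.I * l) := by
  rw [show (u - Complex.I * l : ℂ) = (starRingEnd ℂ) (u + Complex.I * l) by
    simp [sub_eq_add_neg], Complex.Gamma_conj, Complex.mul_conj, Complex.normSq_eq_norm_sq]

lemma gamma_imag_aux (l : ℝ) (hl : l ≠ 0) :
    ((‖Complex.Gamma (2 * Complex.I * l)‖ ^ 2 : ℝ) : ℂ) =
      Real.pi / (2 * l * Complex.sinh (2 * Real.pi * l)) := by
  have hlc : (l : ℂ) ≠ 0 := by exact_mod_cast hl
  have h0 := gamma_normsq_aux 0 (2 * l)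
  have e1 : (((0 : ℝ) : ℂ) + Complex.I * ((2 * l : ℝ) : ℂ)) = 2 * Complex.I * l := by
    push_cast; ring
  have e2 : (((0 : ℝ) : ℂ) - Complex.I * ((2 * l : ℝ) : ℂ)) = -(2 * Complex.I * l) := by
    push_cast; ring
  rw [e1, e2] at h0
  rw [h0]
  have h := Complex.Gamma_mul_Gamma_one_sub (2 * Complex.I * l)
  have hne : -(2 * Complex.I * l) ≠ 0 := by simp [hlc]
  rw [show (1 - 2 * Complex.I * l : ℂ) = -(2 * Complex.I * l) + 1 by ring,
    Complex.Gamma_add_one _ hne,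
    show (Real.pi : ℂ) * (2 * Complex.I * l) = (2 * Real.pi * l) * Complex.I by ring,
    Complex.sin_mul_I] at h
  have hs : Complex.sinh (2 * Real.pi * l) ≠ 0 := by
    have : Real.sinh (2 * Real.pi * l) ≠ 0 := by
      rw [Ne, Real.sinh_eq_zero]
      have := Real.pi_ne_zero
      positivity
    exact_mod_cast this
  have hI := Complex.I_ne_zero
  rw [eq_div_iff (by simp [hlc, hs])]
  rw [eq_div_iff (by simp [hs])] at h
  linear_combination h + (2 * l * Complex.sinh (2 * Real.pi * l) *
    (Complex.Gamma (2 * Complex.I * l) * Complex.Gamma (-(2 * Complex.I * l)))) * Complex.I_sq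

lemma cHC_norm_aux (mv mz : ℕ) : ∃ K : ℝ, 0 < K ∧ ∀ l : ℝ, l ≠ 0 →
    ((‖cHC mv mz l‖ ^ 2 : ℝ) : ℂ) = K / gDR (rhoDR mv mz) (((mv : ℝ) + 2) / 4) l := by
  have hn : 0 < ‖Complex.Gamma (((mv : ℂ) + mz + 1) / 2)‖ := by
    rw [norm_pos_iff]
    apply Complex.Gamma_ne_zero_of_re_pos
    have e : (((mv : ℂ) + mz + 1) / 2) = ((((mv : ℝ) + mz + 1) / 2 : ℝ) : ℂ) := by push_cast; rfl
    rw [e, Complex.ofReal_re]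
    positivity
  refine ⟨((4 : ℝ) ^ rhoDR mv mz) ^ 2 * ‖Complex.Gamma (((mv : ℂ) + mz + 1) / 2)‖ ^ 2 *
    (Real.pi / 2), by have := Real.pi_pos; positivity, fun l hl => ?_⟩
  have h4 : ‖(4 : ℂ) ^ ((rhoDR mv mz : ℂ) - Complex.I * l)‖ = (4 : ℝ) ^ rhoDR mv mz := by
    have := Complex.norm_cpow_eq_rpow_re_of_pos (x := 4) (by norm_num)
      ((rhoDR mv mz : ℂ) - Complex.I * l)
    simpa using this
  have eb : ((mv : ℂ) + 4 * Complex.I * l + 2) / 4 =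
      ((((mv : ℝ) + 2) / 4 : ℝ) : ℂ) + Complex.I * l := by push_cast; ring
  rw [cHC, eb, norm_mul, norm_mul, norm_div, norm_div, h4, mul_pow, mul_pow, div_pow, div_pow]
  rw [Complex.ofReal_mul, Complex.ofReal_mul, Complex.ofReal_div, Complex.ofReal_div,
    gamma_imag_aux l hl, gamma_normsq_aux, gamma_normsq_aux, gDR]
  push_cast
  simp only [div_eq_mul_inv, mul_inv]
  ring

lemma sign_aux (x d : ℝ) (hx : d ≤ |x|) : ∃ s : ℝ, |s| = 1 ∧ ∀ t : ℝ, |t - x| < d → |t| = s * t := by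
  rcases abs_cases x with ⟨e, _⟩ | ⟨e, _⟩
  · refine ⟨1, by simp, fun t ht => ?_⟩
    rw [abs_lt] at ht
    rw [abs_of_pos (by linarith), one_mul]
  · refine ⟨-1, by simp, fun t ht => ?_⟩
    rw [abs_lt] at ht
    rw [abs_of_neg (by linarith)]
    ring

lemma away_aux (mv mz : ℕ) (hmv : 0 < mv) (hmz : 0 < mz) (δ : ℝ) (hδ : 0 < δ)
    (κ : SchwartzMap ℝ ℂ) (hκ : ∀ x : ℝ, |x| < δ → κ x = 0) :
    (∃ σ : SchwartzMap ℝ ℂ, ∀ x, σ x = (multDR mv mz x : ℂ) * κ x) ∧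
    (∃ σ : SchwartzMap ℝ ℂ, ∀ x,
      σ x = ((‖cHC mv mz x‖ ^ 2 * |x| ^ (mv + mz) : ℝ) : ℂ) * κ x) := by
  have hmv' : (1 : ℝ) ≤ mv := by exact_mod_cast hmv
  have hmz' : (1 : ℝ) ≤ mz := by exact_mod_cast hmz
  have ha : 3 / 4 ≤ rhoDR mv mz := by rw [rhoDR]; linarith
  have hb : 3 / 4 ≤ ((mv : ℝ) + 2) / 4 := by linarith
  obtain ⟨K, hK, hKc⟩ := cHC_norm_aux mv mz
  set a := rhoDR mv mz
  set b := ((mv : ℝ) + 2) / 4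
  set k := mv + mz with hk
  obtain ⟨C, c, N, hC, hc, hB⟩ := gDR_bounds a b (δ / 4) ha hb (by positivity)
  set r := min (δ / 4) (1 / 4) with hr
  have hrp : 0 < r := by positivity
  have hball : ∀ x : ℝ, δ / 2 < |x| → ∀ w ∈ Metric.ball (x : ℂ) r,
      |w.im| ≤ 1 / 4 ∧ δ / 4 ≤ |w.re| ∧ |w.re| ≤ 1 + |x| := by
    intro x hx w hw
    rw [mem_ball_iff_norm] at hw
    have h1 := (Complex.abs_im_le_norm (w - x)).trans hw.le
    have h2 := (Complex.abs_re_le_norm (w - x)).trans hw.le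
    simp at h1 h2
    have r1 : r ≤ δ / 4 := min_le_left _ _
    have r2 : r ≤ 1 / 4 := min_le_right _ _
    have t1 := abs_sub_abs_le_abs_sub x w.re
    have t2 := abs_sub_abs_le_abs_sub w.re x
    rw [abs_sub_comm] at t1
    refine ⟨by linarith, by linarith, by linarith⟩
  have hreal : ∀ x : ℝ, ∀ t : ℝ, (t : ℂ) ∈ Metric.ball (x : ℂ) r → |t - x| < δ / 4 := by
    intro x t ht
    rw [mem_ball_iff_norm, ← Complex.ofReal_sub, Complex.norm_real, Real.norm_eq_abs] at ht
    exact ht.trans_le (min_le_left _ _)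
  have hnorm : ∀ x : ℝ, δ / 2 < |x| → ∀ w ∈ Metric.ball (x : ℂ) r,
      δ / 4 ≤ ‖w‖ ∧ ‖w‖ ≤ 2 * (1 + |x|) := by
    intro x hx w hw
    obtain ⟨h1, h2, h3⟩ := hball x hx w hw
    refine ⟨h2.trans (Complex.abs_re_le_norm w), ?_⟩
    have := Complex.norm_le_abs_re_add_abs_im w
    have := abs_nonneg x
    linarith
  have hgne : ∀ x : ℝ, δ / 2 < |x| → ∀ w ∈ Metric.ball (x : ℂ) r, gDR a b w ≠ 0 := by
    intro x hx w hw
    obtain ⟨h1, h2, h3⟩ := hball x hx w hw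
    exact norm_pos_iff.1 (hc.trans_le (hB w h1 h2).2)
  constructor
  · refine schwartz_mul_aux (fun x => (multDR mv mz x : ℂ)) δ r
      (C * 2 ^ N / K * ((δ / 4) ^ k)⁻¹) N hδ hrp ?_ κ hκ
    intro x hx
    obtain ⟨s, hs, hst⟩ := sign_aux x (δ / 4) (by linarith)
    have hs0 : (s : ℂ) ≠ 0 := by
      intro h
      have : s = 0 := by exact_mod_cast h
      simp [this] at hs
    refine ⟨fun w => gDR a b w / K * ((s * w) ^ k)⁻¹, ?_, ?_, ?_⟩
    · intro w hw
      have h1 := gDR_diff a b ha hb w (hball x hx w hw).1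
      have hw0 : w ≠ 0 := norm_pos_iff.1 (lt_of_lt_of_le (by positivity) (hnorm x hx w hw).1)
      have h2 : DifferentiableAt ℂ (fun w : ℂ => ((s * w) ^ k)⁻¹) w :=
        DifferentiableAt.inv (by fun_prop) (pow_ne_zero _ (mul_ne_zero hs0 hw0))
      exact ((h1.div_const _).mul h2).differentiableWithinAt
    · intro w hw
      obtain ⟨h1, h2, h3⟩ := hball x hx w hw
      have h4 := (hB w h1 h2).1
      have h5 := (hnorm x hx w hw).1
      have h6 : 1 + |w.re| ≤ 2 * (1 + |x|) := by have := abs_nonneg x; linarith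
      simp only [norm_mul, norm_div, norm_inv, norm_pow, Complex.norm_real, Real.norm_eq_abs, hs,
        abs_of_pos hK, one_mul]
      calc _ ≤ C * (2 * (1 + |x|)) ^ N / K * ((δ / 4) ^ k)⁻¹ := by
            gcongr
            exact h4.trans (by gcongr)
        _ = _ := by rw [mul_pow]; ring
    · intro t ht
      have ht0 : t ≠ 0 := by
        have := (hnorm x hx t ht).1
        rintro rfl
        simp at this
        linarith
      have hc' := hKc t ht0
      rw [multDR, hst t (hreal x t ht)]
      push_cast at hc' ⊢
      rw [hc', inv_div]
  · refine schwartz_mul_aux (fun x => ((‖cHC mv mz x‖ ^ 2 * |x| ^ (mv + mz) : ℝ) : ℂ)) δ r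
      (K / c * 2 ^ k) k hδ hrp ?_ κ hκ
    intro x hx
    obtain ⟨s, hs, hst⟩ := sign_aux x (δ / 4) (by linarith)
    refine ⟨fun w => K / gDR a b w * (s * w) ^ k, ?_, ?_, ?_⟩
    · intro w hw
      have h1 := gDR_diff a b ha hb w (hball x hx w hw).1
      have h2 : DifferentiableAt ℂ (fun w : ℂ => (s * w) ^ k) w := by fun_prop
      have h3 : DifferentiableAt ℂ (fun w : ℂ => K / gDR a b w) w :=
        (differentiableAt_const _).div h1 (hgne x hx w hw)
      exact (h3.mul h2).differentiableWithinAt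
    · intro w hw
      obtain ⟨h1, h2, h3⟩ := hball x hx w hw
      have h4 := (hB w h1 h2).2
      have h5 := (hnorm x hx w hw).2
      simp only [norm_mul, norm_div, norm_pow, Complex.norm_real, Real.norm_eq_abs, hs,
        abs_of_pos hK, one_mul]
      calc _ ≤ K / c * (2 * (1 + |x|)) ^ k := by gcongr
        _ = _ := by rw [mul_pow]; ring
    · intro t ht
      have ht0 : t ≠ 0 := by
        have := (hnorm x hx t ht).1
        rintro rfl
        simp at this
        linarith
      have hc' := hKc t ht0
      rw [hst t (hreal x t ht)]
      push_cast at hc' ⊢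
      rw [hc']

lemma cHC_even_aux (mv mz : ℕ) (l : ℝ) : ‖cHC mv mz (-l)‖ ^ 2 = ‖cHC mv mz l‖ ^ 2 := by
  by_cases hl : l = 0
  · simp [hl]
  obtain ⟨K, hK, hKc⟩ := cHC_norm_aux mv mz
  have h1 := hKc l hl
  have h2 := hKc (-l) (neg_ne_zero.2 hl)
  rw [Complex.ofReal_neg, gDR_neg, ← h1] at h2
  exact_mod_cast h2

lemma multDR_even_aux (mv mz : ℕ) (l : ℝ) : multDR mv mz (-l) = multDR mv mz l := by
  rw [multDR, multDR, cHC_even_aux, abs_neg]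

lemma cHC_ne_aux (mv mz : ℕ) (hmv : 0 < mv) (hmz : 0 < mz) (l : ℝ) (hl : l ≠ 0) :
    ‖cHC mv mz l‖ ^ 2 ≠ 0 := by
  have hmv' : (1 : ℝ) ≤ mv := by exact_mod_cast hmv
  have hmz' : (1 : ℝ) ≤ mz := by exact_mod_cast hmz
  have ha : 3 / 4 ≤ rhoDR mv mz := by rw [rhoDR]; linarith
  have hb : 3 / 4 ≤ ((mv : ℝ) + 2) / 4 := by linarith
  obtain ⟨K, hK, hKc⟩ := cHC_norm_aux mv mz
  obtain ⟨C, c, N, hC, hc, hB⟩ := gDR_bounds _ _ |l| ha hb (abs_pos.2 hl)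
  have hg := norm_pos_iff.1 (hc.trans_le (hB l (by simp) (by simp)).2)
  have h : ((‖cHC mv mz l‖ ^ 2 : ℝ) : ℂ) ≠ 0 := by
    rw [hKc l hl]
    exact div_ne_zero (by exact_mod_cast hK.ne') hg
  exact_mod_cast h



/-- The multiplier map `𝔪` of Lemma 3.1: for an even Schwartz `κ` vanishing on
`(-δ, δ)`, both `λ ↦ |c(λ)|⁻² |λ|^{-(n-1)} κ(λ)` and `λ ↦ |c(λ)|² |λ|^{n-1} κ(λ)`
(extended by `0` near the origin) are again even Schwartz functions vanishing on
`(-δ, δ)`; consequently `𝔪` is a bijection of the space of even Schwartz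
functions supported away from a neighbourhood of `0`. -/
theorem multiplier_bijection (mv mz : ℕ) (hmv : 0 < mv) (hmz : 0 < mz) :
    (∀ δ : ℝ, 0 < δ → ∀ κ : SchwartzMap ℝ ℂ,
      (∀ x, κ (-x) = κ x) → (∀ x : ℝ, |x| < δ → κ x = 0) →
      (∃ σ : SchwartzMap ℝ ℂ, (∀ x, σ (-x) = σ x) ∧
        (∀ x : ℝ, |x| < δ → σ x = 0) ∧
        ∀ l : ℝ, δ ≤ |l| → σ l = (multDR mv mz l : ℂ) * κ l) ∧
      (∃ τ : SchwartzMap ℝ ℂ, (∀ x, τ (-x) = τ x) ∧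
        (∀ x : ℝ, |x| < δ → τ x = 0) ∧
        ∀ l : ℝ, δ ≤ |l| →
          τ l = ((‖cHC mv mz l‖ ^ 2 * |l| ^ (mv + mz) : ℝ) : ℂ) * κ l)) ∧
    (∀ σ : SchwartzMap ℝ ℂ, EvenAwayZero σ →
      ∃ κ : SchwartzMap ℝ ℂ, EvenAwayZero κ ∧
        ∀ l : ℝ, l ≠ 0 → σ l = (multDR mv mz l : ℂ) * κ l) ∧
    (∀ κ₁ κ₂ : SchwartzMap ℝ ℂ, EvenAwayZero κ₁ → EvenAwayZero κ₂ →
      (∀ l : ℝ, l ≠ 0 →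
        (multDR mv mz l : ℂ) * κ₁ l = (multDR mv mz l : ℂ) * κ₂ l) →
      κ₁ = κ₂) := by
  have hev2 : ∀ x : ℝ, ‖cHC mv mz (-x)‖ ^ 2 * |-x| ^ (mv + mz) =
      ‖cHC mv mz x‖ ^ 2 * |x| ^ (mv + mz) := fun x => by rw [cHC_even_aux, abs_neg]
  refine ⟨?_, ?_, ?_⟩
  · intro δ hδ κ he hz
    obtain ⟨⟨σ, hσ⟩, ⟨τ, hτ⟩⟩ := away_aux mv mz hmv hmz δ hδ κ hz
    refine ⟨⟨σ, fun x => ?_, fun x hx => ?_, fun l _ => hσ l⟩,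
      ⟨τ, fun x => ?_, fun x hx => ?_, fun l _ => hτ l⟩⟩
    · rw [hσ, hσ, he, multDR_even_aux]
    · rw [hσ, hz x hx, mul_zero]
    · rw [hτ, hτ, he, hev2]
    · rw [hτ, hz x hx, mul_zero]
  · rintro σ ⟨he, δ, hδ, hz⟩
    obtain ⟨-, ⟨τ, hτ⟩⟩ := away_aux mv mz hmv hmz δ hδ σ hz
    refine ⟨τ, ⟨fun x => ?_, δ, hδ, fun x hx => ?_⟩, fun l hl => ?_⟩
    · rw [hτ, hτ, he, hev2]
    · rw [hτ, hz x hx, mul_zero]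
    · have h1 := cHC_ne_aux mv mz hmv hmz l hl
      have h2 : |l| ^ (mv + mz) ≠ 0 := pow_ne_zero _ (abs_ne_zero.2 hl)
      rw [hτ, ← mul_assoc, ← Complex.ofReal_mul, multDR,
        show (‖cHC mv mz l‖ ^ 2)⁻¹ * (|l| ^ (mv + mz))⁻¹ *
          (‖cHC mv mz l‖ ^ 2 * |l| ^ (mv + mz)) = 1 by
          rw [← mul_inv, inv_mul_cancel₀ (mul_ne_zero h1 h2)]]
      simp
  · rintro κ₁ κ₂ ⟨-, δ₁, hδ₁, h₁⟩ ⟨-, δ₂, hδ₂, h₂⟩ h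
    ext l
    by_cases hl : l = 0
    · rw [h₁ l (by simpa [hl] using hδ₁), h₂ l (by simpa [hl] using hδ₂)]
    · refine mul_left_cancel₀ ?_ (h l hl)
      have h1 := cHC_ne_aux mv mz hmv hmz l hl
      have h2 : |l| ^ (mv + mz) ≠ 0 := pow_ne_zero _ (abs_ne_zero.2 hl)
      exact_mod_cast mul_ne_zero (inv_ne_zero h1) (inv_ne_zero h2)
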